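/- Let m ≥ 1 be an integer and let α be a real number with 0 < α < 1. Then the integral ∫_{(0,∞)^m} (1+x_1+…+x_m)^{(α−1)(m+1)} · (x_1⋯x_m)^{−α} dx_1⋯dx_m is finite. -/

import Mathlib

open scoped BigOperators
open MeasureTheory

/-- The function `(1 + x)^(-c) * x^(-a)` is integrable on `(0, ∞)` if `a < 1 < a + c`. -/
theorem integrableOn_one_add_rpow_mul_rpow {a c : ℝ} (ha : a < 1)
    (hac : 1 < a + c) :
    IntegrableOn (fun x : ℝ => (1 + x) ^ (-c) * x ^ (-a)) (Set.Ioi 0) := by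
  have hmeas : Measurable (fun x : ℝ => (1 + x) ^ (-c) * x ^ (-a)) := by fun_prop
  rw [← Set.Ioc_union_Ioi_eq_Ioi (zero_le_one' ℝ)]
  refine IntegrableOn.union ?_ ?_
  · have h : IntegrableOn (fun x : ℝ => x ^ (-a)) (Set.Ioc 0 1) :=
      (intervalIntegrable_iff_integrableOn_Ioc_of_le zero_le_one).1
        (intervalIntegral.intervalIntegrable_rpow' (by linarith))
    refine Integrable.mono' h hmeas.aestronglyMeasurable ?_
    refine (ae_restrict_iff' measurableSet_Ioc).2 (.of_forall fun x hx => ?_)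
    have hx0 : 0 < x := hx.1
    rw [Real.norm_of_nonneg (by positivity)]
    exact mul_le_of_le_one_left (by positivity)
      (Real.rpow_le_one_of_one_le_of_nonpos (by linarith) (by linarith))
  · have h : IntegrableOn (fun x : ℝ => x ^ (-(a + c))) (Set.Ioi 1) :=
      integrableOn_Ioi_rpow_of_lt (by linarith) one_pos
    refine Integrable.mono' h hmeas.aestronglyMeasurable ?_
    refine (ae_restrict_iff' measurableSet_Ioi).2 (.of_forall fun x hx => ?_)
    have hx0 : 0 < x := one_pos.trans hx
    rw [Real.norm_of_nonneg (by positivity), neg_add_rev, Real.rpow_add hx0]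
    exact mul_le_mul_of_nonneg_right
      (Real.rpow_le_rpow_of_nonpos hx0 (by linarith) (by linarith)) (by positivity)

/-- For `m ≥ 1` and `0 < α < 1`, the integral
`∫_{(0,∞)^m} (1+x_1+…+x_m)^{(α−1)(m+1)} (x_1⋯x_m)^{−α} dx` is finite. -/
theorem integral_orthant_finite
    (m : ℕ) (hm : 1 ≤ m) (α : ℝ) (hα0 : 0 < α) (hα1 : α < 1) :
    (∫⁻ x : Fin m → ℝ in {x | ∀ i, 0 < x i},
        ENNReal.ofReal
          ((1 + ∑ i, x i) ^ ((α - 1) * ((m : ℝ) + 1)) * (∏ i, x i) ^ (-α)))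
      < ⊤ := by
  have hm0 : (0 : ℝ) < m := by exact_mod_cast hm
  have hβ : 0 < 1 - α := by linarith
  set c : ℝ := (1 - α) * (m + 1) / m with hc_def
  have hc : 0 ≤ c := by positivity
  have hcm : (α - 1) * ((m : ℝ) + 1) = -c * m := by
    rw [hc_def]; field_simp; ring
  have hac : 1 < α + c := by
    have : c = (1 - α) + (1 - α) / m := by rw [hc_def]; field_simp
    have : 0 < (1 - α) / m := by positivity
    linarith
  have hset : {x : Fin m → ℝ | ∀ i, 0 < x i} = Set.univ.pi fun _ => Set.Ioi 0 := by
    ext x; simp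
  have hprod : Integrable (fun x : Fin m → ℝ => ∏ i, ((1 + x i) ^ (-c) * x i ^ (-α)))
      (volume.restrict {x : Fin m → ℝ | ∀ i, 0 < x i}) := by
    rw [hset, volume_pi, Measure.restrict_pi_pi]
    exact Integrable.fintype_prod
      (f := fun (_ : Fin m) (t : ℝ) => (1 + t) ^ (-c) * t ^ (-α))
      fun _ => integrableOn_one_add_rpow_mul_rpow hα1 hac
  refine lt_of_le_of_lt (setLIntegral_mono' ?_ fun x hx => ?_) hprod.lintegral_lt_top
  · rw [hset]
    exact MeasurableSet.univ_pi fun _ => measurableSet_Ioi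
  · have hx' : ∀ i, 0 < x i := hx
    have hsum : 0 ≤ ∑ i, x i := Finset.sum_nonneg fun i _ => (hx' i).le
    refine ENNReal.ofReal_le_ofReal ?_
    rw [Finset.prod_mul_distrib, Real.finsetProd_rpow _ _ fun i _ => (hx' i).le]
    refine mul_le_mul_of_nonneg_right ?_
      (Real.rpow_nonneg (Finset.prod_nonneg fun i _ => (hx' i).le) _)
    rw [hcm, Real.rpow_mul_natCast (by linarith)]
    calc ((1 + ∑ i, x i) ^ (-c)) ^ m = ∏ _i : Fin m, (1 + ∑ i, x i) ^ (-c) := by simp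
      _ ≤ ∏ i, (1 + x i) ^ (-c) := by
        refine Finset.prod_le_prod (fun i _ => by positivity) fun i _ => ?_
        refine Real.rpow_le_rpow_of_nonpos (by linarith [hx' i]) ?_ (by linarith)
        gcongr
        exact Finset.single_le_sum (fun j _ => (hx' j).le) (Finset.mem_univ i)
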